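/- Let T be a densely defined self-adjoint operator on a complex Hilbert space H with bounded transform S. For f ∈ C(σ(T)), let f(T) be the closure of the operator f₀(T) defined on C*_c(S)H by f₀(T) h(T)ψ = (fh)(T)ψ for h ∈ C_c(σ(T)). Then f(T)* = f*(T), where f*(x) = conj(f(x)). -/

import Mathlib

noncomputable section

variable {H : Type*} [NormedAddCommGroup H] [InnerProductSpace ℂ H] [CompleteSpace H]

/-- `S = T(I + T²)^{-1/2}`, the *bounded transform* of the (possibly unbounded) operator `T`.
This is witnessed by `C = (I + T²)⁻¹` (a positive bounded operator mapping into the domain of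
`T²` with `(I + T²) ∘ C = I`, which determines `C` uniquely when `T` is self-adjoint) together
with its (unique) positive square root `R = (I + T²)^{-1/2}`, and `S = T ∘ R`. -/
def IsBoundedTransform (T : H →ₗ.[ℂ] H) (S : H →L[ℂ] H) : Prop :=
  ∃ C R : H →L[ℂ] H, C.IsPositive ∧ R.IsPositive ∧ R * R = C ∧
    (∀ x : H, ∃ (h1 : C x ∈ T.domain) (h2 : (T ⟨C x, h1⟩ : H) ∈ T.domain),
        C x + T ⟨(T ⟨C x, h1⟩ : H), h2⟩ = x) ∧
    (∀ x : H, ∃ hx : R x ∈ T.domain, S x = T ⟨R x, hx⟩)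

/-- `S` is a pure contraction: `‖Sx‖ < ‖x‖` for all `x ≠ 0`. -/
def PureContraction (S : H →L[ℂ] H) : Prop := ∀ x : H, x ≠ 0 → ‖S x‖ < ‖x‖

/-- `T = S(I - S²)^{-1/2}`: witnessed by the (unique) positive square root `R` of `I - S²`,
with `D(T) = ran R` and `T ∘ R = S`. -/
def IsInverseBoundedTransform (S : H →L[ℂ] H) (T : H →ₗ.[ℂ] H) : Prop :=
  ∃ R : H →L[ℂ] H, R.IsPositive ∧ R * R = 1 - S * S ∧
    (T.domain : Set H) = Set.range R ∧
    (∀ x : H, ∃ hx : R x ∈ T.domain, (T ⟨R x, hx⟩ : H) = S x)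

/-- The resolvent set of an unbounded operator: `z` such that `T - z` has a (bounded,
everywhere defined) two-sided inverse. -/
def pmapResolventSet (T : H →ₗ.[ℂ] H) : Set ℂ :=
  {z | ∃ B : H →L[ℂ] H,
    (∀ x : H, ∃ h : B x ∈ T.domain, (T ⟨B x, h⟩ : H) - z • B x = x) ∧
    (∀ ψ : T.domain, B ((T ψ : H) - z • (ψ : H)) = ψ)}

/-- The spectrum of an unbounded operator. -/
def pmapSpectrum (T : H →ₗ.[ℂ] H) : Set ℂ := (pmapResolventSet T)ᶜ

/-- The real points of the spectrum of `T` (all of them, if `T` is self-adjoint). -/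
def realSpec (T : H →ₗ.[ℂ] H) : Set ℝ := {x : ℝ | (x : ℂ) ∈ pmapSpectrum T}

/-- `g(S)` for a function `g : ℝ → ℂ`, via the continuous functional calculus of `S`. -/
def boundedCalc (S : H →L[ℂ] H) (g : ℝ → ℂ) : H →L[ℂ] H :=
  cfc (fun z : ℂ => g z.re) S

/-- The homeomorphism `u : (-1,1) → ℝ`, `u(x) = x(1 - x²)^{-1/2}`. -/
def uFun : ℝ → ℝ := fun x => x / Real.sqrt (1 - x ^ 2)

/-- `h ∘ u`, extended by `0` outside `(-1,1)`. -/
def compU (h : ℝ → ℂ) : ℝ → ℂ :=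
  fun x => if x ∈ Set.Ioo (-1 : ℝ) 1 then h (uFun x) else 0

/-- `h(T) := (h ∘ u)(S)`, for a function `h` on `σ(T)`, where `S` is the bounded
transform of `T`. -/
def pmapCalc (S : H →L[ℂ] H) (h : ℝ → ℂ) : H →L[ℂ] H := boundedCalc S (compU h)

/-- `σ̃(S) = σ(S) ∩ (-1,1)`. -/
def tildeSpec (S : H →L[ℂ] H) : Set ℝ := spectrum ℝ S ∩ Set.Ioo (-1) 1

/-- `g ∈ C_c(Ω)`: continuous on `Ω`, vanishing outside a compact subset of `Ω`
(functions on `Ω` are encoded as functions on `ℝ` vanishing identically outside `Ω`). -/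
def MemCc (g : ℝ → ℂ) (Ω : Set ℝ) : Prop :=
  ContinuousOn g Ω ∧ ∃ K : Set ℝ, IsCompact K ∧ K ⊆ Ω ∧ ∀ x ∉ K, g x = 0

/-- `g ∈ C₀(Ω)`: continuous on `Ω` and vanishing at infinity on `Ω`. -/
def MemC0 (g : ℝ → ℂ) (Ω : Set ℝ) : Prop :=
  ContinuousOn g Ω ∧ (∀ x ∉ Ω, g x = 0) ∧
    ∀ ε > 0, ∃ K : Set ℝ, IsCompact K ∧ K ⊆ Ω ∧ ∀ x ∈ Ω \ K, ‖g x‖ < ε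

/-- `g ∈ C_b(Ω)`: continuous and bounded on `Ω`. -/
def MemCb (g : ℝ → ℂ) (Ω : Set ℝ) : Prop :=
  ContinuousOn g Ω ∧ ∃ M : ℝ, ∀ x ∈ Ω, ‖g x‖ ≤ M

/-- The supremum norm `‖f‖_∞` of `f` over `Ω`. -/
def supNorm (f : ℝ → ℂ) (Ω : Set ℝ) : ℝ := sSup ((fun x => ‖f x‖) '' Ω)

/-- The subspace `C*_c(S)H`: the linear span of all `g(S)ψ` with `g ∈ C_c(σ̃(S))`. -/
def ccSpan (S : H →L[ℂ] H) : Submodule ℂ H :=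
  Submodule.span ℂ
    {v : H | ∃ g : ℝ → ℂ, MemCc g (tildeSpec S) ∧ ∃ ψ : H, v = boundedCalc S g ψ}

/-- The subspace `C*₀(S)H`: the linear span of all `g(S)ψ` with `g ∈ C₀(σ̃(S))`. -/
def c0Span (S : H →L[ℂ] H) : Submodule ℂ H :=
  Submodule.span ℂ
    {v : H | ∃ g : ℝ → ℂ, MemC0 g (tildeSpec S) ∧ ∃ ψ : H, v = boundedCalc S g ψ}

/-- `TR ⊂ RT`: the bounded operator `R` commutes with the unbounded operator `T`. -/
def CommutesPMap (T : H →ₗ.[ℂ] H) (R : H →L[ℂ] H) : Prop :=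
  ∀ ψ : T.domain, ∃ h : R (ψ : H) ∈ T.domain, (T ⟨R (ψ : H), h⟩ : H) = R (T ψ)

/-- `A = f₀(T)`: the operator with domain `C*_c(S)H` determined by
`f₀(T) h(T)ψ = (fh)(T)ψ` for `h ∈ C_c(σ(T))` (where `σT` is the spectrum of `T`,
and `h(T) = (h∘u)(S)`). -/
def IsF0 (S : H →L[ℂ] H) (σT : Set ℝ) (f : ℝ → ℂ) (A : H →ₗ.[ℂ] H) : Prop :=
  A.domain = ccSpan S ∧
  ∀ h : ℝ → ℂ, MemCc h σT → ∀ ψ : H,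
    ∃ hm : pmapCalc S h ψ ∈ A.domain,
      A ⟨pmapCalc S h ψ, hm⟩ = pmapCalc S (fun x => f x * h x) ψ

section FunctionalCalculus

variable {S : H →L[ℂ] H} {g h F : ℝ → ℂ}

theorem re_mem_spectrum_of_isSelfAdjoint (hS : IsSelfAdjoint S) {z : ℂ} (hz : z ∈ spectrum ℂ S) :
    z.re ∈ spectrum ℝ S := by
  rw [hS.mem_spectrum_eq_re hz] at hz
  exact (spectrum.algebraMap_mem_iff ℂ).mp hz

theorem continuousOn_comp_re (hS : IsSelfAdjoint S) (hg : ContinuousOn g (spectrum ℝ S)) :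
    ContinuousOn (fun z : ℂ => g z.re) (spectrum ℂ S) :=
  hg.comp Complex.continuous_re.continuousOn fun _ hz => re_mem_spectrum_of_isSelfAdjoint hS hz

theorem boundedCalc_congr (hS : IsSelfAdjoint S) (hgh : Set.EqOn g h (spectrum ℝ S)) :
    boundedCalc S g = boundedCalc S h :=
  cfc_congr fun _ hz => hgh (re_mem_spectrum_of_isSelfAdjoint hS hz)

theorem boundedCalc_mul (hS : IsSelfAdjoint S) (hg : ContinuousOn g (spectrum ℝ S))
    (hh : ContinuousOn h (spectrum ℝ S)) :
    boundedCalc S (fun x => g x * h x) = boundedCalc S g * boundedCalc S h :=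
  cfc_mul _ _ S (continuousOn_comp_re hS hg) (continuousOn_comp_re hS hh)

theorem boundedCalc_sub (hS : IsSelfAdjoint S) (hg : ContinuousOn g (spectrum ℝ S))
    (hh : ContinuousOn h (spectrum ℝ S)) :
    boundedCalc S (fun x => g x - h x) = boundedCalc S g - boundedCalc S h :=
  cfc_sub _ _ S (continuousOn_comp_re hS hg) (continuousOn_comp_re hS hh)

theorem inner_boundedCalc_left (S : H →L[ℂ] H) (g : ℝ → ℂ) (φ ψ : H) :
    inner ℂ (boundedCalc S g φ) ψ
      = inner ℂ φ (boundedCalc S (fun x => starRingEnd ℂ (g x)) ψ) := by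
  have : boundedCalc S (fun x => starRingEnd ℂ (g x)) = star (boundedCalc S g) :=
    cfc_star _ _
  rw [this, ContinuousLinearMap.star_eq_adjoint, ContinuousLinearMap.adjoint_inner_right]

theorem boundedCalc_one_sub_sq (hS : IsSelfAdjoint S) :
    boundedCalc S (fun x => 1 - (x : ℂ) * x) = 1 - S * S := by
  have hid : boundedCalc S (fun x => (x : ℂ)) = S := by
    have : boundedCalc S (fun x => (x : ℂ)) = cfc (fun z : ℂ => z) S :=
      cfc_congr fun z hz => (hS.mem_spectrum_eq_re hz).symm
    rw [this, cfc_id' ℂ S hS.isStarNormal]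
  have hone : boundedCalc S (fun _ => 1) = 1 := cfc_const_one ℂ S hS.isStarNormal
  rw [boundedCalc_sub hS (by fun_prop) (by fun_prop), boundedCalc_mul hS (by fun_prop)
    (by fun_prop), hid, hone]

theorem norm_boundedCalc_le (hS : IsSelfAdjoint S) {c : ℝ} (hc : 0 ≤ c)
    (hg : ∀ x ∈ spectrum ℝ S, ‖g x‖ ≤ c) : ‖boundedCalc S g‖ ≤ c :=
  norm_cfc_le hc fun _ hz => hg _ (re_mem_spectrum_of_isSelfAdjoint hS hz)

omit [CompleteSpace H] in
theorem MemCc.continuousOn_spectrum (hg : MemCc g (tildeSpec S)) :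
    ContinuousOn g (spectrum ℝ S) := by
  obtain ⟨hg, K, hK, hKΩ, hg0⟩ := hg
  intro x hx
  by_cases hxI : x ∈ Set.Ioo (-1 : ℝ) 1
  · exact (hg x ⟨hx, hxI⟩).mono_of_mem_nhdsWithin
      (Filter.inter_mem self_mem_nhdsWithin (mem_nhdsWithin_of_mem_nhds (isOpen_Ioo.mem_nhds hxI)))
  · have hxK : x ∈ Kᶜ := fun h => hxI (hKΩ h).2
    refine ContinuousAt.continuousWithinAt ?_
    refine (continuousAt_const (y := (0 : ℂ))).congr ?_
    filter_upwards [hK.isClosed.isOpen_compl.mem_nhds hxK] with y hy using (hg0 y hy).symm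

theorem memCc_indicator {K : Set ℝ} (hK : IsCompact K) (hKI : K ⊆ Set.Ioo (-1) 1)
    (hg : ContinuousOn g (tildeSpec S)) (hg0 : ∀ x ∈ tildeSpec S, x ∉ K → g x = 0) :
    MemCc ((tildeSpec S).indicator g) (tildeSpec S) := by
  refine ⟨hg.congr fun x hx => Set.indicator_of_mem hx g, spectrum ℝ S ∩ K,
    hK.inter_left (spectrum.isClosed S), fun x hx => ⟨hx.1, hKI hx.2⟩, fun x hx => ?_⟩
  by_cases hxΩ : x ∈ tildeSpec S
  · rw [Set.indicator_of_mem hxΩ, hg0 x hxΩ fun h => hx ⟨hxΩ.1, h⟩]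
  · exact Set.indicator_of_notMem hxΩ g

theorem MemCc.mul_left {Ω : Set ℝ} (hF : ContinuousOn F Ω) (hg : MemCc g Ω) :
    MemCc (fun x => F x * g x) Ω := by
  obtain ⟨hg, K, hK, hKΩ, hg0⟩ := hg
  exact ⟨hF.mul hg, K, hK, hKΩ, fun x hx => by simp [hg0 x hx]⟩

/-- A real-valued continuous function with values in `[0, 1]`, supported where `1/(n+1) ≤ 1 - x²`
and equal to `1` where `2/(n+1) ≤ 1 - x²`. -/
def bump (n : ℕ) (x : ℝ) : ℝ := min 1 (max 0 ((n + 1) * (1 - x * x) - 1))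

/-- The restriction of `bump n` to `σ̃(S)`. -/
def cutoff (S : H →L[ℂ] H) (n : ℕ) : ℝ → ℂ := (tildeSpec S).indicator fun x => (bump n x : ℂ)

theorem continuous_bump (n : ℕ) : Continuous (bump n) := by
  unfold bump; fun_prop

theorem bump_nonneg (n : ℕ) (x : ℝ) : 0 ≤ bump n x := le_min zero_le_one (le_max_left _ _)

theorem bump_le_one (n : ℕ) (x : ℝ) : bump n x ≤ 1 := min_le_left _ _

theorem memCc_cutoff (S : H →L[ℂ] H) (n : ℕ) : MemCc (cutoff S n) (tildeSpec S) := by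
  have hn : (0 : ℝ) < n + 1 := by positivity
  have hlt {x : ℝ} (hx : 1 ≤ (n + 1) * (1 - x * x)) : x ∈ Set.Ioo (-1 : ℝ) 1 := by
    have : 0 < 1 - x * x := by
      by_contra! h
      nlinarith
    constructor <;> nlinarith
  refine memCc_indicator (K := {x : ℝ | 1 ≤ (n + 1) * (1 - x * x)}) ?_ (fun x hx => hlt hx)
    (Complex.continuous_ofReal.comp (continuous_bump n)).continuousOn fun x _ hx => ?_
  · exact (isCompact_Icc (a := (-1 : ℝ)) (b := 1)).of_isClosed_subset
      (isClosed_le (by fun_prop) (by fun_prop)) fun x hx => Set.Ioo_subset_Icc_self (hlt hx)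
  · have hx' : (n + 1) * (1 - x * x) - 1 ≤ 0 := by
      have : (n + 1) * (1 - x * x) < 1 := not_le.mp hx
      linarith
    simp [bump, max_eq_left hx']

omit [CompleteSpace H] in
theorem conj_cutoff (S : H →L[ℂ] H) (n : ℕ) (x : ℝ) :
    starRingEnd ℂ (cutoff S n x) = cutoff S n x := by
  by_cases hx : x ∈ tildeSpec S <;> simp [cutoff, hx]

omit [CompleteSpace H] in
theorem norm_cutoff_le_one (S : H →L[ℂ] H) (n : ℕ) (x : ℝ) : ‖cutoff S n x‖ ≤ 1 := by
  by_cases hx : x ∈ tildeSpec S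
  · simpa [cutoff, hx, abs_of_nonneg (bump_nonneg n x)] using bump_le_one n x
  · simp [cutoff, hx]

omit [CompleteSpace H] in
theorem norm_cutoff_mul_sub_le (hσ : spectrum ℝ S ⊆ Set.Icc (-1) 1) (n : ℕ) {x : ℝ}
    (hx : x ∈ spectrum ℝ S) :
    ‖cutoff S n x * (1 - (x : ℂ) * x) - (1 - (x : ℂ) * x)‖ ≤ 2 / (n + 1) := by
  have hn : (0 : ℝ) < n + 1 := by positivity
  by_cases hxΩ : x ∈ tildeSpec S
  · have hx1 : 0 < 1 - x * x := by nlinarith [hxΩ.2.1, hxΩ.2.2]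
    have key : (1 - bump n x) * (1 - x * x) ≤ 2 / (n + 1) := by
      rcases le_total (2 / ((n : ℝ) + 1)) (1 - x * x) with h | h
      · have h2 : 2 ≤ (n + 1) * (1 - x * x) := by
          rwa [div_le_iff₀ hn, mul_comm] at h
        have : bump n x = 1 := min_eq_left (le_max_of_le_right (by linarith))
        rw [this]
        simp only [sub_self, zero_mul]
        positivity
      · nlinarith [bump_nonneg n x, bump_le_one n x]
    have e : cutoff S n x * (1 - (x : ℂ) * x) - (1 - (x : ℂ) * x)
        = ((-((1 - bump n x) * (1 - x * x)) : ℝ) : ℂ) := by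
      simp only [cutoff, Set.indicator_of_mem hxΩ]
      push_cast
      ring
    rw [e, Complex.norm_real, norm_neg, Real.norm_of_nonneg]
    · exact key
    · exact mul_nonneg (sub_nonneg.mpr (bump_le_one n x)) hx1.le
  · have hx1 : x * x = 1 := by
      rcases hσ hx with ⟨h1, h2⟩
      rcases h1.eq_or_lt with h | h
      · rw [← h]; norm_num
      · rcases h2.eq_or_lt with h' | h'
        · rw [h']; norm_num
        · exact absurd ⟨hx, h, h'⟩ hxΩ
    have : (x : ℂ) * x = 1 := by exact_mod_cast hx1
    rw [this]
    simp only [sub_self, mul_zero, norm_zero]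
    positivity

theorem tendsto_boundedCalc_cutoff (hS : IsSelfAdjoint S) (hσ : spectrum ℝ S ⊆ Set.Icc (-1) 1)
    (hd : DenseRange (1 - S * S : H →L[ℂ] H)) (v : H) :
    Filter.Tendsto (fun n => boundedCalc S (cutoff S n) v) Filter.atTop (nhds v) := by
  rw [Metric.tendsto_atTop]
  intro ε hε
  obtain ⟨w, hw⟩ := hd.exists_dist_lt v (by positivity : 0 < ε / 4)
  obtain ⟨N, hN⟩ := exists_nat_gt (8 * (‖w‖ + 1) / ε)
  refine ⟨N, fun n hn => ?_⟩
  have hnorm : ‖boundedCalc S (cutoff S n)‖ ≤ 1 :=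
    norm_boundedCalc_le hS zero_le_one fun x _ => norm_cutoff_le_one S n x
  have hsub : ‖boundedCalc S (cutoff S n) * (1 - S * S) - (1 - S * S)‖ ≤ 2 / (n + 1) := by
    have hcont := (memCc_cutoff S n).continuousOn_spectrum
    rw [← boundedCalc_one_sub_sq hS, ← boundedCalc_mul hS hcont (by fun_prop),
      ← boundedCalc_sub hS (g := fun x => cutoff S n x * (1 - (x : ℂ) * x))
        (hcont.mul (by fun_prop)) (by fun_prop)]
    exact norm_boundedCalc_le hS (by positivity) fun x hx => norm_cutoff_mul_sub_le hσ n hx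
  set X := boundedCalc S (cutoff S n)
  set D := 1 - S * S
  have e : X v - v = X (v - D w) + (X * D - D) w - (v - D w) := by
    simp only [map_sub, sub_apply, mul_apply_eq_comp]
    abel
  rw [dist_eq_norm] at hw ⊢
  have h1 : ‖X (v - D w)‖ ≤ 1 * ‖v - D w‖ := X.le_of_opNorm_le hnorm _
  have h2 : ‖(X * D - D) w‖ ≤ 2 / (n + 1) * ‖w‖ := (X * D - D).le_of_opNorm_le hsub _
  have h3 : 2 / ((n : ℝ) + 1) * ‖w‖ ≤ ε / 4 := by
    have hnN : (N : ℝ) ≤ n := by exact_mod_cast hn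
    rw [div_lt_iff₀ hε] at hN
    rw [div_mul_eq_mul_div, div_le_iff₀ (by positivity)]
    nlinarith
  calc ‖X v - v‖ ≤ ‖X (v - D w) + (X * D - D) w‖ + ‖v - D w‖ := by rw [e]; exact norm_sub_le _ _
    _ ≤ ‖X (v - D w)‖ + ‖(X * D - D) w‖ + ‖v - D w‖ := by gcongr; exact norm_add_le _ _
    _ < ε := by linarith

end FunctionalCalculus

section CalculusGraph

variable {S : H →L[ℂ] H} {F : ℝ → ℂ}

/-- The graph of the operator `g(S)ψ ↦ (Fg)(S)ψ` for `g ∈ C_c(σ̃(S))`. -/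
def calcGraph (S : H →L[ℂ] H) (F : ℝ → ℂ) : Submodule ℂ (H × H) :=
  Submodule.span ℂ {p : H × H | ∃ g : ℝ → ℂ, MemCc g (tildeSpec S) ∧ ∃ ψ : H,
    p = (boundedCalc S g ψ, boundedCalc S (fun x => F x * g x) ψ)}

theorem mk_mem_calcGraph {g : ℝ → ℂ} (hg : MemCc g (tildeSpec S)) (ψ : H) :
    (boundedCalc S g ψ, boundedCalc S (fun x => F x * g x) ψ) ∈ calcGraph S F :=
  Submodule.subset_span ⟨g, hg, ψ, rfl⟩

theorem map_fst_calcGraph (S : H →L[ℂ] H) (F : ℝ → ℂ) :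
    (calcGraph S F).map (LinearMap.fst ℂ H H) = ccSpan S := by
  rw [calcGraph, Submodule.map_span, ccSpan]
  congr 1
  ext v
  constructor
  · rintro ⟨_, ⟨g, hg, ψ, rfl⟩, rfl⟩
    exact ⟨g, hg, ψ, rfl⟩
  · rintro ⟨g, hg, ψ, rfl⟩
    exact ⟨_, ⟨g, hg, ψ, rfl⟩, rfl⟩

theorem calcGraph_conj_le_adjoint (hS : IsSelfAdjoint S) (hF : ContinuousOn F (tildeSpec S)) :
    calcGraph S (fun x => starRingEnd ℂ (F x)) ≤ (calcGraph S F).adjoint := by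
  refine Submodule.span_le.mpr ?_
  rintro _ ⟨h, hh, φ, rfl⟩
  rw [SetLike.mem_coe, Submodule.mem_adjoint_iff]
  suffices H : ∀ p ∈ calcGraph S F, inner ℂ p.2 (boundedCalc S h φ)
      - inner ℂ p.1 (boundedCalc S (fun x => starRingEnd ℂ (F x) * h x) φ) = 0 from
    fun a b hab => H (a, b) hab
  intro p hp
  induction hp using Submodule.span_induction with
  | zero => simp
  | add p q _ _ hp hq =>
    simp only [Prod.fst_add, Prod.snd_add, inner_add_left]
    linear_combination hp + hq
  | smul c p _ hp =>
    simp only [Prod.smul_fst, Prod.smul_snd, inner_smul_left]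
    linear_combination (starRingEnd ℂ c) * hp
  | mem p hp =>
    obtain ⟨g, hg, ψ, rfl⟩ := hp
    have conj {k : ℝ → ℂ} (hk : MemCc k (tildeSpec S)) :
        ContinuousOn (fun x => starRingEnd ℂ (k x)) (spectrum ℝ S) :=
      Complex.continuous_conj.comp_continuousOn hk.continuousOn_spectrum
    have hFh : MemCc (fun x => starRingEnd ℂ (F x) * h x) (tildeSpec S) :=
      hh.mul_left (Complex.continuous_conj.comp_continuousOn hF)
    simp only [inner_boundedCalc_left]
    rw [← mul_apply_eq_comp, ← mul_apply_eq_comp,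
      ← boundedCalc_mul hS (conj (hg.mul_left hF)) hh.continuousOn_spectrum,
      ← boundedCalc_mul hS (conj hg) hFh.continuousOn_spectrum, sub_eq_zero]
    congr 3
    funext x
    simp only [map_mul]
    ring

omit [CompleteSpace H] in
theorem topologicalClosure_adjoint (g : Submodule ℂ (H × H)) :
    g.topologicalClosure.adjoint = g.adjoint := by
  ext ⟨y, z⟩
  simp only [Submodule.mem_adjoint_iff]
  refine ⟨fun h a b hab => h a b (g.le_topologicalClosure hab), fun h a b hab => ?_⟩
  have hcl : IsClosed {p : H × H | inner ℂ p.2 y - inner ℂ p.1 z = 0} :=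
    isClosed_eq (by fun_prop) continuous_const
  exact closure_minimal (fun p hp => h p.1 p.2 hp) hcl hab

theorem dense_ccSpan (hS : IsSelfAdjoint S) (hσ : spectrum ℝ S ⊆ Set.Icc (-1) 1)
    (hd : DenseRange (1 - S * S : H →L[ℂ] H)) : Dense (ccSpan S : Set H) := fun v =>
  mem_closure_of_tendsto (tendsto_boundedCalc_cutoff hS hσ hd v)
    (Filter.Eventually.of_forall fun n => Submodule.subset_span ⟨_, memCc_cutoff S n, v, rfl⟩)

theorem calcGraph_le_adjoint_conj (hS : IsSelfAdjoint S) (hF : ContinuousOn F (tildeSpec S)) :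
    calcGraph S F ≤ (calcGraph S fun x => starRingEnd ℂ (F x)).adjoint := by
  simpa using calcGraph_conj_le_adjoint hS (F := fun x => starRingEnd ℂ (F x))
    (Complex.continuous_conj.comp_continuousOn hF)

theorem calcGraph_adjoint_le_closure (hS : IsSelfAdjoint S) (hσ : spectrum ℝ S ⊆ Set.Icc (-1) 1)
    (hd : DenseRange (1 - S * S : H →L[ℂ] H)) :
    (calcGraph S F).adjoint
      ≤ (calcGraph S fun x => starRingEnd ℂ (F x)).topologicalClosure := by
  rintro ⟨y, z⟩ hyz
  rw [Submodule.mem_adjoint_iff] at hyz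
  refine mem_closure_of_tendsto ((tendsto_boundedCalc_cutoff hS hσ hd y).prodMk_nhds
    (tendsto_boundedCalc_cutoff hS hσ hd z)) (Filter.Eventually.of_forall fun n => ?_)
  have e : boundedCalc S (cutoff S n) z
      = boundedCalc S (fun x => starRingEnd ℂ (F x) * cutoff S n x) y := by
    refine ext_inner_left ℂ fun φ => ?_
    have h := hyz _ _ (mk_mem_calcGraph (memCc_cutoff S n) φ)
    rw [inner_boundedCalc_left, inner_boundedCalc_left, sub_eq_zero] at h
    simpa only [map_mul, conj_cutoff] using h.symm
  rw [e]
  exact mk_mem_calcGraph (memCc_cutoff S n) y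

theorem calcGraph_snd_eq_zero (hS : IsSelfAdjoint S) (hσ : spectrum ℝ S ⊆ Set.Icc (-1) 1)
    (hd : DenseRange (1 - S * S : H →L[ℂ] H)) (hF : ContinuousOn F (tildeSpec S)) (p : H × H)
    (hp : p ∈ calcGraph S F) (hp0 : p.1 = 0) : p.2 = 0 := by
  have h := (Submodule.mem_adjoint_iff _ _).mp (calcGraph_le_adjoint_conj hS hF hp)
  refine (dense_ccSpan hS hσ hd).eq_zero_of_inner_right ℂ fun a ha => ?_
  rw [← map_fst_calcGraph S fun x => starRingEnd ℂ (F x)] at ha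
  obtain ⟨⟨a, b⟩, hab, rfl⟩ := ha
  simpa [hp0] using h a b hab

theorem calcGraph_toLinearPMap_adjoint (hS : IsSelfAdjoint S)
    (hσ : spectrum ℝ S ⊆ Set.Icc (-1) 1) (hd : DenseRange (1 - S * S : H →L[ℂ] H))
    (hF : ContinuousOn F (tildeSpec S)) :
    (calcGraph S F).toLinearPMap.IsClosable ∧
      (calcGraph S F).toLinearPMap.closure.adjoint
        = (calcGraph S fun x => starRingEnd ℂ (F x)).toLinearPMap.closure := by
  have hFc : ContinuousOn (fun x => starRingEnd ℂ (F x)) (tildeSpec S) :=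
    Complex.continuous_conj.comp_continuousOn hF
  have closable {G : ℝ → ℂ} (hG : ContinuousOn G (tildeSpec S)) :
      (calcGraph S G).toLinearPMap.IsClosable := by
    have hGc : ContinuousOn (fun x => starRingEnd ℂ (G x)) (tildeSpec S) :=
      Complex.continuous_conj.comp_continuousOn hG
    have hdense : Dense
        ((calcGraph S fun x => starRingEnd ℂ (G x)).toLinearPMap.domain : Set H) := by
      rw [Submodule.toLinearPMap_domain, map_fst_calcGraph]
      exact dense_ccSpan hS hσ hd
    refine (LinearPMap.adjoint_isClosed hdense).isClosable.leIsClosable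
      (LinearPMap.le_of_le_graph ?_)
    rw [LinearPMap.adjoint_graph_eq_graph_adjoint hdense,
      Submodule.toLinearPMap_graph_eq _ (calcGraph_snd_eq_zero hS hσ hd hG),
      Submodule.toLinearPMap_graph_eq _ (calcGraph_snd_eq_zero hS hσ hd hGc)]
    exact calcGraph_le_adjoint_conj hS hG
  have hdense : Dense ((calcGraph S F).toLinearPMap.closure.domain : Set H) := by
    refine (dense_ccSpan hS hσ hd).mono ?_
    rw [← map_fst_calcGraph S F]
    exact (LinearPMap.le_closure (calcGraph S F).toLinearPMap).1
  refine ⟨closable hF, LinearPMap.eq_of_eq_graph ?_⟩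
  rw [LinearPMap.adjoint_graph_eq_graph_adjoint hdense,
    ← (closable hF).graph_closure_eq_closure_graph,
    ← (closable hFc).graph_closure_eq_closure_graph,
    Submodule.toLinearPMap_graph_eq _ (calcGraph_snd_eq_zero hS hσ hd hF),
    Submodule.toLinearPMap_graph_eq _ (calcGraph_snd_eq_zero hS hσ hd hFc),
    topologicalClosure_adjoint]
  refine le_antisymm (calcGraph_adjoint_le_closure hS hσ hd) ?_
  refine Submodule.topologicalClosure_minimal _ (calcGraph_conj_le_adjoint hS hF) ?_
  rw [← topologicalClosure_adjoint]
  simp only [← SetLike.setOfPred_mem_eq, Submodule.mem_adjoint_iff, Set.ofPred_forall]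
  exact isClosed_iInter fun a => isClosed_iInter fun b => isClosed_iInter fun _ =>
    isClosed_eq (by fun_prop) continuous_const

end CalculusGraph

section BoundedTransform

variable {T : H →ₗ.[ℂ] H} {S : H →L[ℂ] H}

theorem LinearPMap.inner_apply_eq_of_isSelfAdjoint (hT : IsSelfAdjoint T) (x y : T.domain) :
    inner ℂ (T x) (y : H) = inner ℂ (x : H) (T y) := by
  have h := LinearPMap.adjoint_isFormalAdjoint hT.dense_domain
  rw [LinearPMap.isSelfAdjoint_def.mp hT] at h
  exact h x y

theorem ContinuousLinearMap.denseRange_of_isSelfAdjoint {A : H →L[ℂ] H} (hA : IsSelfAdjoint A)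
    (hinj : ∀ x, A x = 0 → x = 0) : DenseRange A := by
  have hker : A.ker = ⊥ := LinearMap.ker_eq_bot'.mpr hinj
  have h := ContinuousLinearMap.orthogonal_ker A
  rw [hker, Submodule.bot_orthogonal_eq_top, ← ContinuousLinearMap.star_eq_adjoint,
    hA.star_eq] at h
  exact Submodule.dense_iff_topologicalClosure_eq_top.mpr h.symm

/-- `(I + T²)^{-1/2}` is a positive square root of `I - S²` through which `S` factors as `T R`. -/
theorem IsBoundedTransform.exists_sqrt (hT : IsSelfAdjoint T) (hbt : IsBoundedTransform T S) :
    IsSelfAdjoint S ∧ ∃ R : H →L[ℂ] H, R.IsPositive ∧ R * R = 1 - S * S ∧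
      (∀ x, R x = 0 → x = 0) ∧ ∀ x, ∃ hx : R x ∈ T.domain, S x = T ⟨R x, hx⟩ := by
  obtain ⟨C, R, hC, hR, hRR, hTC, hTR⟩ := hbt
  have hRsa : IsSelfAdjoint R := hR.isSelfAdjoint
  have hCsa : IsSelfAdjoint C := hC.isSelfAdjoint
  have hsymC (x y : H) : inner ℂ (C x) y = inner ℂ x (C y) := hCsa.isSymmetric x y
  have hRR' (x : H) : R (R x) = C x := by rw [← hRR]; rfl
  have hinjC (x : H) (hx : C x = 0) : x = 0 := by
    obtain ⟨h1, h2, h⟩ := hTC x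
    have hz : (⟨C x, h1⟩ : T.domain) = 0 := Subtype.ext hx
    have hz' : (⟨T ⟨C x, h1⟩, h2⟩ : T.domain) = 0 := Subtype.ext (by simp [hz])
    rw [hz', hx] at h
    simpa using h.symm
  have hinjR (x : H) (hx : R x = 0) : x = 0 := hinjC x (by rw [← hRR', hx, map_zero])
  have hdR : DenseRange R := ContinuousLinearMap.denseRange_of_isSelfAdjoint hRsa hinjR
  have hsymT := LinearPMap.inner_apply_eq_of_isSelfAdjoint hT
  have hSR (x : H) : ∃ hx : C x ∈ T.domain, S (R x) = T ⟨C x, hx⟩ := by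
    obtain ⟨h, e⟩ := hTR (R x)
    have : (⟨R (R x), h⟩ : T.domain) = ⟨C x, hRR' x ▸ h⟩ := Subtype.ext (hRR' x)
    exact ⟨hRR' x ▸ h, by rw [e, this]⟩
  have hTSR (x : H) : ∃ hx : S (R x) ∈ T.domain, C x + T ⟨S (R x), hx⟩ = x := by
    obtain ⟨h1, h2, h⟩ := hTC x
    obtain ⟨h3, e⟩ := hSR x
    have : (⟨T ⟨C x, h1⟩, h2⟩ : T.domain) = ⟨S (R x), e ▸ h2⟩ := Subtype.ext e.symm
    exact ⟨e ▸ h2, by rw [← this]; exact h⟩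
  have hDsym (y z : H) : inner ℂ (S (R y)) z = inner ℂ y (S (R z)) := by
    obtain ⟨hy, ey⟩ := hTSR y
    obtain ⟨hz, ez⟩ := hTSR z
    obtain ⟨hy', ey'⟩ := hSR y
    obtain ⟨hz', ez'⟩ := hSR z
    conv_lhs => rw [← ez]
    conv_rhs => rw [← ey]
    rw [inner_add_right, inner_add_left]
    congr 1
    · rw [ey', ez']
      exact hsymT ⟨C y, hy'⟩ ⟨C z, hz'⟩
    · exact (hsymT ⟨S (R y), hy⟩ ⟨S (R z), hz⟩).symm
  have hD : IsSelfAdjoint (S * R) :=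
    ContinuousLinearMap.isSelfAdjoint_iff_isSymmetric.mpr hDsym
  have hTC_comm (y : T.domain) : C (T y) = S (R y) := by
    refine ext_inner_right ℂ fun z => ?_
    obtain ⟨hz', ez'⟩ := hSR z
    rw [hsymC, hDsym, ez']
    exact hsymT y ⟨C z, hz'⟩
  have hDC : Commute (S * R) C := by
    refine ContinuousLinearMap.ext fun x => ?_
    obtain ⟨hx, ex⟩ := hSR x
    change S (R (C x)) = C (S (R x))
    rw [ex, hTC_comm ⟨C x, hx⟩]
  have hDR : Commute (S * R) R := by
    have hR0 : 0 ≤ R := (ContinuousLinearMap.nonneg_iff_isPositive R).mpr hR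
    have hsqrt := CFC.sqrt_unique hRR hR0
    have : Commute (S * R) (CFC.sqrt C) := (hDC.symm.cfcₙ_nnreal _).symm
    rwa [hsqrt] at this
  have cancel {A B : H →L[ℂ] H} (h : A * R = B * R) : A = B := by
    have : (A : H → H) = B := hdR.equalizer A.continuous B.continuous
      (funext fun x => congrArg (fun f : H →L[ℂ] H => f x) h)
    exact DFunLike.coe_injective this
  have hSR_comm : S * R = R * S := cancel (by
    rw [hDR.eq, mul_assoc])
  have hSsa : IsSelfAdjoint S := by
    have h : star S * R = S * R := by
      have := congrArg star hSR_comm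
      rw [star_mul, star_mul, hRsa.star_eq] at this
      rw [← this, ← hD.star_eq, star_mul, hRsa.star_eq]
    exact cancel h
  refine ⟨hSsa, R, hR, ?_, hinjR, hTR⟩
  have hSS : S * S * R * R = (1 - R * R) * R * R := by
    have h : S * R * (S * R) = (1 - C) * C := by
      refine ContinuousLinearMap.ext fun x => ?_
      obtain ⟨hx, ex⟩ := hTSR x
      change S (R (S (R x))) = C x - C (C x)
      rw [← hTC_comm ⟨S (R x), hx⟩, ← map_sub, ← eq_sub_of_add_eq' ex]
    rw [mul_assoc _ R R, mul_assoc _ R R, hRR, ← h, ← hRR, mul_assoc S R, ← mul_assoc R S R,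
      ← hSR_comm]
    simp only [mul_assoc]
  rw [cancel (cancel hSS), sub_sub_cancel]

theorem isUnit_of_isSelfAdjoint_of_bounded_below {A : H →L[ℂ] H} (hA : IsSelfAdjoint A) {c : ℝ}
    (hc : 0 < c) (h : ∀ x, c * ‖x‖ ≤ ‖A x‖) : IsUnit A := by
  have hsq : IsUnit (A * A) := by
    refine ContinuousLinearMap.isUnit_of_forall_le_norm_inner_map _ (c := ⟨c ^ 2, by positivity⟩)
      (by change 0 < c ^ 2; positivity) fun x => ?_
    have e : inner ℂ ((A * A) x) x = inner ℂ (A x) (A x) := hA.isSymmetric (A x) x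
    rw [e, inner_self_eq_norm_sq_to_K]
    have : (c * ‖x‖) ^ 2 ≤ ‖A x‖ ^ 2 := by gcongr; exact h x
    simp only [norm_pow, RCLike.norm_ofReal, abs_norm]
    change ‖x‖ ^ 2 * c ^ 2 ≤ ‖A x‖ ^ 2
    linarith [mul_pow c ‖x‖ 2]
  exact isUnit_pow_iff two_ne_zero |>.mp (by rwa [pow_two])

theorem spectrum_subset_Icc_of_sq_eq (hS : IsSelfAdjoint S) {R : H →L[ℂ] H}
    (hR : IsSelfAdjoint R) (hRR : R * R = 1 - S * S) : spectrum ℝ S ⊆ Set.Icc (-1) 1 := by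
  have hnorm : ‖S‖ ≤ 1 := by
    refine S.opNorm_le_bound zero_le_one fun x => ?_
    have h := congrArg (fun A : H →L[ℂ] H => inner ℂ (A x) x) hRR
    have e1 : inner ℂ ((R * R) x) x = inner ℂ (R x) (R x) := hR.isSymmetric (R x) x
    have e2 : inner ℂ ((S * S) x) x = inner ℂ (S x) (S x) := hS.isSymmetric (S x) x
    simp only [sub_apply, inner_sub_left, e1, e2, one_apply_eq_self,
      inner_self_eq_norm_sq_to_K] at h
    have h' : ‖R x‖ ^ 2 = ‖x‖ ^ 2 - ‖S x‖ ^ 2 := by exact_mod_cast h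
    rw [one_mul]
    exact (pow_le_pow_iff_left₀ (norm_nonneg _) (norm_nonneg _) two_ne_zero).mp
      (by linarith [sq_nonneg ‖R x‖])
  intro x hx
  have hx' := spectrum.norm_le_norm_mul_of_mem hx
  have hone : ‖(1 : H →L[ℂ] H)‖ ≤ 1 := ContinuousLinearMap.norm_id_le
  rw [Real.norm_eq_abs] at hx'
  exact abs_le.mp (hx'.trans (mul_le_one₀ hnorm (norm_nonneg _) hone))

theorem IsBoundedTransform.uFun_mem_realSpec (hS : IsSelfAdjoint S) {R : H →L[ℂ] H}
    (hR : R.IsPositive) (hRR : R * R = 1 - S * S)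
    (hTR : ∀ x, ∃ hx : R x ∈ T.domain, S x = T ⟨R x, hx⟩) {l : ℝ} (hl : l ∈ tildeSpec S) :
    uFun l ∈ realSpec T := by
  rintro ⟨B, -, hB⟩
  have hpos : 0 < 1 - l ^ 2 := by nlinarith [hl.2.1, hl.2.2]
  set r := Real.sqrt (1 - l ^ 2)
  have hr0 : 0 < r := Real.sqrt_pos.mpr hpos
  have hr2 : r * r = 1 - l ^ 2 := Real.mul_self_sqrt hpos.le
  set m := uFun l
  have hmr : m * r = l := div_mul_cancel₀ l hr0.ne'
  have hlow (v : H) : r * ‖v‖ ≤ ‖R v + (r : ℂ) • v‖ := by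
    rcases eq_or_ne v 0 with rfl | hv
    · simp
    have h1 : r * ‖v‖ * ‖v‖ ≤ (inner ℂ (R v + (r : ℂ) • v) v).re := by
      have h2 : 0 ≤ (inner ℂ (R v) v).re := hR.re_inner_nonneg_left v
      have h3 : (inner ℂ ((r : ℂ) • v) v).re = r * ‖v‖ * ‖v‖ := by
        rw [inner_smul_left, inner_self_eq_norm_sq_to_K, Complex.conj_ofReal, mul_assoc,
          ← pow_two]
        rw [← RCLike.ofReal_pow]
        exact Complex.re_ofReal_mul r ((‖v‖ ^ 2 : ℝ) : ℂ)
      rw [inner_add_left, Complex.add_re, h3]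
      linarith
    exact le_of_mul_le_mul_right (h1.trans (re_inner_le_norm (𝕜 := ℂ) _ _)) (norm_pos_iff.mpr hv)
  have hRr (x : H) : r * ‖R x - (r : ℂ) • x‖ ≤ (‖S‖ + |l|) * ‖S x - (l : ℂ) • x‖ := by
    have hRRx : R (R x) = x - S (S x) := congrArg (fun A : H →L[ℂ] H => A x) hRR
    have hr2' : (r : ℂ) * r = 1 - l * l := by rw [← pow_two (l : ℂ)]; exact_mod_cast hr2
    have e : R (R x - (r : ℂ) • x) + (r : ℂ) • (R x - (r : ℂ) • x)
        = -(S (S x - (l : ℂ) • x) + (l : ℂ) • (S x - (l : ℂ) • x)) := by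
      simp only [map_sub, map_smul, smul_sub, smul_smul, hr2', hRRx, sub_smul, one_smul]
      abel
    refine (hlow _).trans ?_
    rw [e, norm_neg, add_mul]
    refine (norm_add_le _ _).trans (add_le_add (S.le_opNorm _) ?_)
    rw [norm_smul, Complex.norm_real, Real.norm_eq_abs]
  have hRx (x : H) : ‖R x‖ ≤ ‖B‖ * (‖S x - (l : ℂ) • x‖ + |m| * ‖R x - (r : ℂ) • x‖) := by
    obtain ⟨hx, ex⟩ := hTR x
    have h := hB ⟨R x, hx⟩
    have hmr' : (m : ℂ) * r = l := by exact_mod_cast hmr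
    have e : T ⟨R x, hx⟩ - (m : ℂ) • R x
        = (S x - (l : ℂ) • x) - (m : ℂ) • (R x - (r : ℂ) • x) := by
      rw [← ex, smul_sub, smul_smul, hmr']
      abel
    change B (T ⟨R x, hx⟩ - (m : ℂ) • R x) = R x at h
    rw [e] at h
    conv_lhs => rw [← h]
    refine (B.le_opNorm _).trans (mul_le_mul_of_nonneg_left ?_ (norm_nonneg B))
    refine (norm_sub_le _ _).trans_eq ?_
    rw [norm_smul, Complex.norm_real, Real.norm_eq_abs]
  have hbelow (x : H) :
      r * ‖x‖ ≤ (‖B‖ + (‖B‖ * |m| + 1) * ((‖S‖ + |l|) / r) + 1) * ‖S x - (l : ℂ) • x‖ := by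
    set W := ‖S x - (l : ℂ) • x‖
    have h1 : ‖R x - (r : ℂ) • x‖ ≤ (‖S‖ + |l|) / r * W := by
      rw [div_mul_eq_mul_div, le_div_iff₀ hr0, mul_comm]
      exact hRr x
    have h2 : r * ‖x‖ ≤ ‖R x‖ + ‖R x - (r : ℂ) • x‖ := by
      have : ‖(r : ℂ) • x‖ = r * ‖x‖ := by
        rw [norm_smul, Complex.norm_real, Real.norm_of_nonneg hr0.le]
      rw [← this]
      refine (norm_sub_le (R x) (R x - (r : ℂ) • x)).trans' ?_
      rw [sub_sub_cancel]
    calc r * ‖x‖ ≤ ‖B‖ * W + (‖B‖ * |m| + 1) * ‖R x - (r : ℂ) • x‖ := by linarith [hRx x]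
      _ ≤ ‖B‖ * W + (‖B‖ * |m| + 1) * ((‖S‖ + |l|) / r * W) := by gcongr
      _ ≤ _ := by linarith [norm_nonneg (S x - (l : ℂ) • x)]
  set K := ‖B‖ + (‖B‖ * |m| + 1) * ((‖S‖ + |l|) / r) + 1
  have hK0 : 0 < K := by positivity
  refine hl.1 (isUnit_of_isSelfAdjoint_of_bounded_below (c := r / K)
    ((IsSelfAdjoint.algebraMap _ (IsSelfAdjoint.all l)).sub hS) (by positivity) fun x => ?_)
  have e : (algebraMap ℝ (H →L[ℂ] H) l - S) x = -(S x - (l : ℂ) • x) := by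
    rw [sub_apply, Algebra.algebraMap_eq_smul_one, neg_sub]
    rfl
  rw [e, norm_neg, div_mul_eq_mul_div, div_le_iff₀ hK0, mul_comm _ K]
  exact hbelow x

end BoundedTransform

section UnboundedCalculus

variable {S : H →L[ℂ] H} {Ω : Set ℝ} {f h : ℝ → ℂ}

theorem continuousOn_uFun : ContinuousOn uFun (Set.Ioo (-1) 1) :=
  continuousOn_id.div (by fun_prop) fun x hx =>
    (Real.sqrt_pos.mpr (by nlinarith [hx.1, hx.2] : 0 < 1 - x ^ 2)).ne'

omit [CompleteSpace H] in
theorem continuousOn_compU (hu : Set.MapsTo uFun (tildeSpec S) Ω) (hf : ContinuousOn f Ω) :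
    ContinuousOn (compU f) (tildeSpec S) :=
  (hf.comp (continuousOn_uFun.mono fun _ hx => hx.2) hu).congr fun _ hx => if_pos hx.2

theorem compU_mul (f h : ℝ → ℂ) :
    compU (fun x => f x * h x) = fun x => compU f x * compU h x := by
  funext x
  simp only [compU]
  split_ifs <;> simp

theorem compU_conj (f : ℝ → ℂ) :
    compU (fun x => starRingEnd ℂ (f x)) = fun x => starRingEnd ℂ (compU f x) := by
  funext x
  simp only [compU]
  split_ifs <;> simp

theorem uFun_leftInvOn :
    Set.LeftInvOn (fun y : ℝ => y / Real.sqrt (1 + y ^ 2)) uFun (Set.Ioo (-1) 1) := by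
  intro x hx
  have hpos : 0 < 1 - x ^ 2 := by nlinarith [hx.1, hx.2]
  have hs := Real.sqrt_pos.mpr hpos
  have e : 1 + uFun x ^ 2 = (Real.sqrt (1 - x ^ 2))⁻¹ ^ 2 := by
    rw [uFun, div_pow, inv_pow, Real.sq_sqrt hpos.le]
    field_simp
    ring
  simp only [e, Real.sqrt_sq (inv_nonneg.mpr hs.le)]
  rw [uFun]
  field_simp

theorem div_sqrt_one_add_sq_mem_Ioo (y : ℝ) : y / Real.sqrt (1 + y ^ 2) ∈ Set.Ioo (-1 : ℝ) 1 := by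
  have hs : 0 < Real.sqrt (1 + y ^ 2) := Real.sqrt_pos.mpr (by positivity)
  have h : |y| < Real.sqrt (1 + y ^ 2) := by
    rw [← Real.sqrt_sq_eq_abs]
    exact Real.sqrt_lt_sqrt (sq_nonneg y) (by linarith)
  rw [abs_lt] at h
  constructor
  · rw [lt_div_iff₀ hs]; linarith
  · rw [div_lt_iff₀ hs]; linarith

theorem memCc_indicator_compU (hu : Set.MapsTo uFun (tildeSpec S) Ω) (hh : MemCc h Ω) :
    MemCc ((tildeSpec S).indicator (compU h)) (tildeSpec S) := by
  obtain ⟨hc, K, hK, -, hh0⟩ := hh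
  refine memCc_indicator (K := (fun y : ℝ => y / Real.sqrt (1 + y ^ 2)) '' K)
    (hK.image (by fun_prop (disch := intros; positivity))) ?_
    (continuousOn_compU hu hc) fun x hx hxK => ?_
  · rintro _ ⟨y, -, rfl⟩
    exact div_sqrt_one_add_sq_mem_Ioo y
  · rw [compU, if_pos hx.2]
    exact hh0 _ fun hy => hxK ⟨uFun x, hy, uFun_leftInvOn hx.2⟩

theorem boundedCalc_indicator_compU (hS : IsSelfAdjoint S) (h : ℝ → ℂ) :
    boundedCalc S ((tildeSpec S).indicator (compU h)) = pmapCalc S h := by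
  refine boundedCalc_congr hS fun x hx => ?_
  by_cases hxI : x ∈ Set.Ioo (-1 : ℝ) 1
  · exact Set.indicator_of_mem (show x ∈ tildeSpec S from ⟨hx, hxI⟩) (compU h)
  · rw [Set.indicator_of_notMem fun h => hxI h.2, compU, if_neg hxI]

theorem isF0_calcGraph_toLinearPMap (hS : IsSelfAdjoint S) (hσ : spectrum ℝ S ⊆ Set.Icc (-1) 1)
    (hd : DenseRange (1 - S * S : H →L[ℂ] H)) (hu : Set.MapsTo uFun (tildeSpec S) Ω)
    (hf : ContinuousOn f Ω) : IsF0 S Ω f (calcGraph S (compU f)).toLinearPMap := by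
  refine ⟨map_fst_calcGraph S _, fun h hh ψ => ?_⟩
  have hmem := mk_mem_calcGraph (F := compU f) (memCc_indicator_compU hu hh) ψ
  have e : (fun x => compU f x * (tildeSpec S).indicator (compU h) x)
      = (tildeSpec S).indicator (compU fun x => f x * h x) := by
    funext x
    rw [compU_mul]
    by_cases hx : x ∈ tildeSpec S <;> simp [hx]
  rw [e, boundedCalc_indicator_compU hS, boundedCalc_indicator_compU hS,
    ← Submodule.toLinearPMap_graph_eq _
      (calcGraph_snd_eq_zero hS hσ hd (continuousOn_compU hu hf)),
    LinearPMap.mem_graph_iff] at hmem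
  obtain ⟨⟨v, hv⟩, rfl, hy⟩ := hmem
  exact ⟨hv, hy⟩

end UnboundedCalculus

/-- For `f ∈ C(σ(T))`, with `f(T)` the closure of `f₀(T)`, one has `f(T)* = f*(T)`. -/
theorem fT_adjoint_eq_conj_fT (T : H →ₗ.[ℂ] H) (S : H →L[ℂ] H)
    (hdense : Dense (T.domain : Set H)) (hsa : IsSelfAdjoint T)
    (hbt : IsBoundedTransform T S) (f : ℝ → ℂ) (hf : ContinuousOn f (realSpec T)) :
    ∃ A B : H →ₗ.[ℂ] H, IsF0 S (realSpec T) f A ∧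
      IsF0 S (realSpec T) (fun x => starRingEnd ℂ (f x)) B ∧
      A.IsClosable ∧ B.IsClosable ∧ A.closure.adjoint = B.closure := by
  obtain ⟨hS, R, hR, hRR, hinj, hTR⟩ := hbt.exists_sqrt hsa
  have hRsa : IsSelfAdjoint R := hR.isSelfAdjoint
  have hσ := spectrum_subset_Icc_of_sq_eq hS hRsa hRR
  have hd : DenseRange (1 - S * S : H →L[ℂ] H) := by
    rw [← hRR]
    exact ContinuousLinearMap.denseRange_of_isSelfAdjoint (hRsa.commute_iff hRsa |>.mp rfl)
      fun x hx => hinj x (hinj (R x) hx)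
  have hu : Set.MapsTo uFun (tildeSpec S) (realSpec T) := fun _ hl =>
    IsBoundedTransform.uFun_mem_realSpec hS hR hRR hTR hl
  have hfc : ContinuousOn (fun x => starRingEnd ℂ (f x)) (realSpec T) :=
    Complex.continuous_conj.comp_continuousOn hf
  have h := calcGraph_toLinearPMap_adjoint hS hσ hd (continuousOn_compU hu hf)
  have h' := calcGraph_toLinearPMap_adjoint hS hσ hd (continuousOn_compU hu hfc)
  rw [← compU_conj] at h
  exact ⟨_, _, isF0_calcGraph_toLinearPMap hS hσ hd hu hf,
    isF0_calcGraph_toLinearPMap hS hσ hd hu hfc, h.1, h'.1, h.2⟩
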